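/- arXiv:2008.04177 — 2 statements merged into one kernel-verified Lean document; each statement's English description precedes it below -/
import Mathlib

section
/- For each q ∈ (0,1) there exists a unique r₀ ∈ (q, 1) such that κ(r₀; q) = 0; moreover κ(r; q) < 0 for every r ∈ (q, r₀) and κ(r; q) > 0 for every r ∈ (r₀, 1). In particular κ(q; q) < 0 < κ(1; q). -/
/-- `W_q(z)`: the Weierstrass ℘-function with periods `2π` and `-2i log q`,
evaluated at `-i log z`, as an explicit series. -/
noncomputable def W (q z : ℝ) : ℝ :=
  -1 / 12 - z / (1 - z) ^ 2 + 2 * ∑' n : ℕ, q ^ (2 * (n + 1)) / (1 - q ^ (2 * (n + 1))) ^ 2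
    - ∑' n : ℕ, z * q ^ (2 * (n + 1)) / (1 - z * q ^ (2 * (n + 1))) ^ 2
    - ∑' n : ℕ, (q ^ (2 * (n + 1)) / z) / (1 - q ^ (2 * (n + 1)) / z) ^ 2

noncomputable def e1 (q : ℝ) : ℝ := W q (-1)
noncomputable def e2 (q : ℝ) : ℝ := W q (-q)
noncomputable def e3 (q : ℝ) : ℝ := W q q
noncomputable def g2 (q : ℝ) : ℝ := 2 * (e1 q ^ 2 + e2 q ^ 2 + e3 q ^ 2)

/-- `κ(r;q) = 5 W_q(-r)² + 2 e₁ W_q(-r) - (e₁² + g₂/2)`. -/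
noncomputable def kappa (q r : ℝ) : ℝ :=
  5 * W q (-r) ^ 2 + 2 * e1 q * W q (-r) - (e1 q ^ 2 + g2 q / 2)

/-- The Koebe function `x / (1 - x)²`. -/
noncomputable def koebe (x : ℝ) : ℝ := x / (1 - x) ^ 2

/-- The logistic density in the exponential variable: `x / (1 + x)²`. -/
noncomputable def logisticDensity (x : ℝ) : ℝ := x / (1 + x) ^ 2

/-- The `q²`-periodization of `logisticDensity`. -/
noncomputable def periodizedLogistic (q r : ℝ) : ℝ :=
  logisticDensity r + ∑' n : ℕ, logisticDensity (r * q ^ (2 * (n + 1)))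
    + ∑' n : ℕ, logisticDensity (q ^ (2 * (n + 1)) / r)

lemma W_neg (q r : ℝ) :
    W q (-r) = -1 / 12 + 2 * ∑' n : ℕ, koebe (q ^ (2 * (n + 1))) + periodizedLogistic q r := by
  have h1 (n : ℕ) : -r * q ^ (2 * (n + 1)) / (1 - -r * q ^ (2 * (n + 1))) ^ 2
      = -logisticDensity (r * q ^ (2 * (n + 1))) := by
    simp only [logisticDensity]; ring
  have h2 (n : ℕ) : (q ^ (2 * (n + 1)) / -r) / (1 - q ^ (2 * (n + 1)) / -r) ^ 2
      = -logisticDensity (q ^ (2 * (n + 1)) / r) := by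
    simp only [logisticDensity]; ring
  simp only [W, h1, h2, tsum_neg, periodizedLogistic]
  simp only [koebe, logisticDensity]
  ring

lemma logisticDensity_nonneg {x : ℝ} (hx : 0 ≤ x) : 0 ≤ logisticDensity x := by
  unfold logisticDensity; positivity

lemma logisticDensity_le_self {x : ℝ} (hx : 0 ≤ x) : logisticDensity x ≤ x :=
  div_le_self hx (by nlinarith)

lemma koebe_eq_logisticDensity_add {x : ℝ} (h0 : 0 ≤ x) (h1 : x < 1) :
    koebe x = logisticDensity x + 4 * koebe (x ^ 2) := by
  have h2 : 1 - x ≠ 0 := by linarith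
  have h3 : 1 + x ≠ 0 := by linarith
  have h4 : 1 - x ^ 2 = (1 - x) * (1 + x) := by ring
  simp only [koebe, logisticDensity, h4]
  field_simp
  ring

lemma koebe_strictMonoOn : StrictMonoOn koebe (Set.Ico 0 1) := by
  rintro x ⟨hx0, hx1⟩ y ⟨hy0, hy1⟩ hxy
  have h2 : 0 < 1 - x := by linarith
  have h3 : 0 < 1 - y := by linarith
  simp only [koebe]
  rw [div_lt_div_iff₀ (by positivity) (by positivity)]
  have : 0 < (y - x) * (1 - x * y) := mul_pos (by linarith) (by nlinarith)
  nlinarith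

section
variable {q : ℝ}

lemma summable_even_pow (h0 : 0 < q) (h1 : q < 1) :
    Summable fun n : ℕ ↦ q ^ (2 * (n + 1)) := by
  have : Summable fun n : ℕ ↦ (q ^ 2) ^ n :=
    summable_geometric_of_lt_one (by positivity) (by nlinarith)
  exact (this.mul_left (q ^ 2)).congr fun n ↦ by ring

lemma summable_logisticDensity_mul (h0 : 0 < q) (h1 : q < 1) {r : ℝ} (hr : 0 < r) :
    Summable fun n : ℕ ↦ logisticDensity (r * q ^ (2 * (n + 1))) :=
  ((summable_even_pow h0 h1).mul_left r).of_nonneg_of_le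
    (fun n ↦ logisticDensity_nonneg (by positivity))
    (fun n ↦ logisticDensity_le_self (by positivity))

lemma summable_logisticDensity_div (h0 : 0 < q) (h1 : q < 1) {r : ℝ} (hr : 0 < r) :
    Summable fun n : ℕ ↦ logisticDensity (q ^ (2 * (n + 1)) / r) :=
  ((summable_even_pow h0 h1).div_const r).of_nonneg_of_le
    (fun n ↦ logisticDensity_nonneg (by positivity))
    (fun n ↦ logisticDensity_le_self (by positivity))

lemma summable_koebe_pow (h0 : 0 < q) (h1 : q < 1) :
    Summable fun n : ℕ ↦ koebe (q ^ (n + 1)) := by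
  have hg : Summable fun n : ℕ ↦ q ^ (n + 1) :=
    (summable_nat_add_iff 1).2 (summable_geometric_of_lt_one h0.le h1)
  have hq : 0 < 1 - q := by linarith
  refine (hg.div_const ((1 - q) ^ 2)).of_nonneg_of_le
    (fun n ↦ div_nonneg (by positivity) (sq_nonneg _)) (fun n ↦ ?_)
  have : q ^ (n + 1) ≤ q := pow_le_of_le_one h0.le h1.le (by simp)
  unfold koebe
  gcongr

lemma summable_koebe_even (h0 : 0 < q) (h1 : q < 1) :
    Summable fun n : ℕ ↦ koebe (q ^ (2 * (n + 1))) := by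
  simpa only [pow_mul] using summable_koebe_pow (q := q ^ 2) (by positivity) (by nlinarith)

lemma summable_koebe_odd (h0 : 0 < q) (h1 : q < 1) :
    Summable fun n : ℕ ↦ koebe (q ^ (2 * n + 1)) :=
  (summable_koebe_pow h0 h1).comp_injective
    (i := fun n : ℕ ↦ 2 * n) (fun a b h ↦ by simpa using h)

lemma tsum_koebe_even_add_odd (h0 : 0 < q) (h1 : q < 1) :
    ∑' n : ℕ, koebe (q ^ (2 * n + 1)) + ∑' n : ℕ, koebe (q ^ (2 * (n + 1)))
      = ∑' n : ℕ, koebe (q ^ (n + 1)) :=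
  tsum_even_add_odd (f := fun n ↦ koebe (q ^ (n + 1))) (summable_koebe_odd h0 h1)
    (summable_koebe_even h0 h1)

lemma summable_logisticDensity_pow (h0 : 0 < q) (h1 : q < 1) :
    Summable fun n : ℕ ↦ logisticDensity (q ^ (n + 1)) :=
  ((summable_nat_add_iff 1).2 (summable_geometric_of_lt_one h0.le h1)).of_nonneg_of_le
    (fun n ↦ logisticDensity_nonneg (by positivity))
    (fun n ↦ logisticDensity_le_self (by positivity))

lemma summable_logisticDensity_odd (h0 : 0 < q) (h1 : q < 1) :
    Summable fun n : ℕ ↦ logisticDensity (q ^ (2 * n + 1)) :=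
  (summable_logisticDensity_pow h0 h1).comp_injective
    (i := fun n : ℕ ↦ 2 * n) (fun a b h ↦ by simpa using h)

lemma tsum_logisticDensity (h0 : 0 < q) (h1 : q < 1) :
    ∑' n : ℕ, logisticDensity (q ^ (n + 1))
      = ∑' n : ℕ, koebe (q ^ (n + 1)) - 4 * ∑' n : ℕ, koebe (q ^ (2 * (n + 1))) := by
  rw [← tsum_mul_left, ← (summable_koebe_pow h0 h1).tsum_sub
    ((summable_koebe_even h0 h1).mul_left 4)]
  refine tsum_congr fun n ↦ ?_
  rw [koebe_eq_logisticDensity_add (by positivity) (pow_lt_one₀ h0.le h1 (by simp)), ← pow_mul,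
    mul_comm (n + 1) 2]
  ring

lemma periodizedLogistic_one (q : ℝ) :
    periodizedLogistic q 1 = 1 / 4 + 2 * ∑' n : ℕ, logisticDensity (q ^ (2 * (n + 1))) := by
  simp only [periodizedLogistic, one_mul, div_one, logisticDensity]
  ring

lemma periodizedLogistic_self (h0 : 0 < q) (h1 : q < 1) :
    periodizedLogistic q q = 2 * ∑' n : ℕ, logisticDensity (q ^ (2 * n + 1)) := by
  have h2 (n : ℕ) : q ^ (2 * (n + 1)) / q = q ^ (2 * n + 1) := by
    field_simp; ring
  have h3 (n : ℕ) : q * q ^ (2 * (n + 1)) = q ^ (2 * (n + 1) + 1) := by ring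
  have h4 := (summable_logisticDensity_odd h0 h1).tsum_eq_zero_add
  simp only [periodizedLogistic, h2, h3]
  simp only [mul_zero, zero_add, pow_one] at h4
  linarith

lemma W_self (h0 : 0 < q) (h1 : q < 1) :
    W q q = -1 / 12 + 2 * ∑' n : ℕ, koebe (q ^ (2 * (n + 1)))
      - 2 * ∑' n : ℕ, koebe (q ^ (2 * n + 1)) := by
  have h2 (n : ℕ) : (q ^ (2 * (n + 1)) / q) / (1 - q ^ (2 * (n + 1)) / q) ^ 2
      = koebe (q ^ (2 * n + 1)) := by
    rw [koebe, show q ^ (2 * (n + 1)) / q = q ^ (2 * n + 1) by field_simp; ring]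
  have h3 (n : ℕ) : q * q ^ (2 * (n + 1)) / (1 - q * q ^ (2 * (n + 1))) ^ 2
      = koebe (q ^ (2 * (n + 1) + 1)) := by
    rw [koebe, show q * q ^ (2 * (n + 1)) = q ^ (2 * (n + 1) + 1) by ring]
  have h4 := (summable_koebe_odd h0 h1).tsum_eq_zero_add
  simp only [mul_zero, zero_add, pow_one] at h4
  simp only [W, h2, h3]
  simp only [koebe] at h4 ⊢
  linarith

lemma e1_add_e2_add_e3 (h0 : 0 < q) (h1 : q < 1) : e1 q + e2 q + e3 q = 0 := by
  have hq0 : 0 < q ^ 2 := by positivity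
  have hq1 : q ^ 2 < 1 := by nlinarith
  have hE := tsum_logisticDensity hq0 hq1
  have hS := tsum_koebe_even_add_odd hq0 hq1
  have hO : ∑' n : ℕ, koebe (q ^ (2 * n + 1)) = ∑' n : ℕ, logisticDensity (q ^ (2 * n + 1))
      + 4 * ∑' n : ℕ, koebe ((q ^ 2) ^ (2 * n + 1)) := by
    rw [← tsum_mul_left, ← (summable_logisticDensity_odd h0 h1).tsum_add
      ((summable_koebe_odd hq0 hq1).mul_left 4)]
    refine tsum_congr fun n ↦ ?_
    rw [koebe_eq_logisticDensity_add (by positivity) (pow_lt_one₀ h0.le h1 (by simp)), ← pow_mul,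
      ← pow_mul, mul_comm 2 (2 * n + 1)]
  have h2 (n : ℕ) : (q ^ 2) ^ (n + 1) = q ^ (2 * (n + 1)) := (pow_mul _ _ _).symm
  have h3 (n : ℕ) : (q ^ 2) ^ (2 * n + 1) = q ^ (2 * (2 * n + 1)) := (pow_mul _ _ _).symm
  simp only [h2] at hE hS
  simp only [h3] at hO
  rw [e1, e2, e3, W_neg, W_neg, W_self h0 h1, periodizedLogistic_one,
    periodizedLogistic_self h0 h1]
  linarith

lemma e3_neg (h0 : 0 < q) (h1 : q < 1) : e3 q < 0 := by
  have : ∑' n : ℕ, koebe (q ^ (2 * (n + 1))) ≤ ∑' n : ℕ, koebe (q ^ (2 * n + 1)) := by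
    refine (summable_koebe_even h0 h1).tsum_le_tsum (fun n ↦ ?_) (summable_koebe_odd h0 h1)
    refine (koebe_strictMonoOn ⟨by positivity, pow_lt_one₀ h0.le h1 (by simp)⟩
      ⟨by positivity, pow_lt_one₀ h0.le h1 (by simp)⟩ ?_).le
    exact pow_lt_pow_right_of_lt_one₀ h0 h1 (by lia)
  rw [e3, W_self h0 h1]
  linarith

lemma continuousOn_periodizedLogistic (h0 : 0 < q) (h1 : q < 1) :
    ContinuousOn (periodizedLogistic q) (Set.Icc q 1) := by
  have hpos {x : ℝ} (hx : x ∈ Set.Icc q 1) : 0 < x := h0.trans_le hx.1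
  have hc : ContinuousOn logisticDensity (Set.Ioi 0) := by
    unfold logisticDensity
    refine continuousOn_id.div (by fun_prop) fun x hx ↦ ?_
    have : 0 < x := hx
    positivity
  refine ((hc.mono fun x hx ↦ hpos hx).add (continuousOn_tsum (u := fun n ↦ q ^ (2 * (n + 1)))
    (fun n ↦ hc.comp (by fun_prop) fun x hx ↦ ?_) (summable_even_pow h0 h1) fun n x hx ↦ ?_)).add
    (continuousOn_tsum (u := fun n ↦ q ^ (2 * (n + 1)) / q)
    (fun n ↦ hc.comp (continuousOn_const.div continuousOn_id fun x hx ↦ (hpos hx).ne')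
      fun x hx ↦ ?_) ((summable_even_pow h0 h1).div_const q) fun n x hx ↦ ?_)
  · have := hpos hx
    simp only [Set.mem_Ioi]; positivity
  · have := hpos hx
    rw [Function.comp_apply, Real.norm_of_nonneg (logisticDensity_nonneg (by positivity))]
    exact (logisticDensity_le_self (by positivity)).trans
      (mul_le_of_le_one_left (by positivity) hx.2)
  · have := hpos hx
    simp only [Set.mem_Ioi]; positivity
  · have := hpos hx
    rw [Real.norm_of_nonneg (logisticDensity_nonneg (by positivity))]
    refine (logisticDensity_le_self (by positivity)).trans ?_
    have := hx.1
    gcongr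
end

lemma logisticDensity_add {a b : ℝ} (ha : 0 < a) (hb : 0 < b) :
    logisticDensity a + logisticDensity b
      = (1 + a * b) * (1 + a + b + a * b)⁻¹
        - (1 - a * b) ^ 2 * (1 + a + b + a * b)⁻¹ ^ 2 := by
  have h : 1 + a + b + a * b = (1 + a) * (1 + b) := by ring
  rw [h, logisticDensity, logisticDensity]
  field_simp
  ring

lemma logisticDensity_add_lt {a b a' b' : ℝ} (ha : 0 < a) (hb : 0 < b) (ha' : 0 < a')
    (hb' : 0 < b') (hc : a * b = a' * b') (hc1 : a' * b' ≤ 1 / 361) (h : a + b < a' + b')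
    (h' : a' + b' ≤ 6 / 19) :
    logisticDensity a + logisticDensity b < logisticDensity a' + logisticDensity b' := by
  rw [logisticDensity_add ha hb, logisticDensity_add ha' hb', hc]
  have hc0 : 0 < a' * b' := by positivity
  set c := a' * b'
  have hY : 0 < 1 + a + b + c := by positivity
  have huu : (1 + a' + b' + c)⁻¹ < (1 + a + b + c)⁻¹ := by
    gcongr 1
    linarith
  have hu' : 3 / 4 ≤ (1 + a' + b' + c)⁻¹ := by
    rw [le_inv_comm₀ (by norm_num) (by positivity)]
    linarith
  set u := (1 + a + b + c)⁻¹
  set u' := (1 + a' + b' + c)⁻¹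
  have hc2 : 99 / 100 ≤ (1 - c) ^ 2 := by nlinarith
  have key : 0 < (u - u') * ((1 - c) ^ 2 * (u + u') - (1 + c)) :=
    mul_pos (by linarith) (by nlinarith)
  nlinarith

lemma logisticDensity_add_sub_le {a b a' b' : ℝ} (ha : 0 < a) (hb : 0 < b) (ha' : 0 < a')
    (hb' : 0 < b') (hc : a * b = a' * b') (hc1 : a' * b' ≤ 1) (h : a' + b' ≤ a + b) :
    logisticDensity a + logisticDensity b - (logisticDensity a' + logisticDensity b')
      ≤ a + b - (a' + b') := by
  rw [logisticDensity_add ha hb, logisticDensity_add ha' hb', hc]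
  have hc0 : 0 < a' * b' := by positivity
  set c := a' * b'
  have hY : 1 ≤ 1 + a + b + c := by linarith
  have hY' : 1 ≤ 1 + a' + b' + c := by linarith
  have hu1 : (1 + a + b + c)⁻¹ ≤ 1 := inv_le_one_of_one_le₀ hY
  have hu1' : (1 + a' + b' + c)⁻¹ ≤ 1 := inv_le_one_of_one_le₀ hY'
  have huu : (1 + a + b + c)⁻¹ ≤ (1 + a' + b' + c)⁻¹ := by
    gcongr 1
    linarith
  have hdiff : (1 + a' + b' + c)⁻¹ - (1 + a + b + c)⁻¹ ≤ a + b - (a' + b') := by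
    rw [inv_sub_inv (by positivity) (by positivity)]
    refine (div_le_self (by linarith) (by nlinarith)).trans (by linarith)
  have hu0 : 0 < (1 + a + b + c)⁻¹ := by positivity
  set u := (1 + a + b + c)⁻¹
  set u' := (1 + a' + b' + c)⁻¹
  have hc2 : (1 - c) ^ 2 ≤ 1 := by nlinarith
  have key : (u' - u) * ((1 - c) ^ 2 * (u + u') - (1 + c)) ≤ (u' - u) * 1 :=
    mul_le_mul_of_nonneg_left (by nlinarith) (by linarith)
  nlinarith

section
variable {q : ℝ}

lemma periodizedLogistic_eq_tsum_even (h0 : 0 < q) (h1 : q < 1) {r : ℝ} (hr : 0 < r) :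
    Summable (fun n : ℕ ↦ logisticDensity (r * q ^ (2 * n))
      + logisticDensity (q ^ (2 * (n + 1)) / r)) ∧
    periodizedLogistic q r = ∑' n : ℕ, (logisticDensity (r * q ^ (2 * n))
      + logisticDensity (q ^ (2 * (n + 1)) / r)) := by
  have hs : Summable fun n : ℕ ↦ logisticDensity (r * q ^ (2 * n)) :=
    (summable_nat_add_iff 1).1 (summable_logisticDensity_mul h0 h1 hr)
  refine ⟨hs.add (summable_logisticDensity_div h0 h1 hr), ?_⟩
  rw [hs.tsum_add (summable_logisticDensity_div h0 h1 hr), hs.tsum_eq_zero_add,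
    periodizedLogistic]
  simp

lemma periodizedLogistic_strictMonoOn_left (h0 : 0 < q) (h1 : q < 1 / 19) :
    StrictMonoOn (periodizedLogistic q) (Set.Icc q (5 * q)) := by
  rintro r ⟨hr, hr'⟩ t ⟨ht, ht'⟩ hrt
  have hr0 : 0 < r := by linarith
  have ht0 : 0 < t := by linarith
  obtain ⟨hs, he⟩ := periodizedLogistic_eq_tsum_even h0 (by linarith) hr0
  obtain ⟨hs', he'⟩ := periodizedLogistic_eq_tsum_even h0 (by linarith) ht0
  rw [he, he']
  have hsum : r + q ^ 2 / r < t + q ^ 2 / t := by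
    have : t + q ^ 2 / t - (r + q ^ 2 / r) = (t - r) * (r * t - q ^ 2) / (r * t) := by
      field_simp; ring
    have : 0 < (t - r) * (r * t - q ^ 2) / (r * t) :=
      div_pos (mul_pos (by linarith) (by nlinarith)) (by positivity)
    linarith
  have hsum' : t + q ^ 2 / t ≤ 6 / 19 := by
    have : q ^ 2 / t ≤ q := by rw [div_le_iff₀ ht0]; nlinarith
    linarith
  have key (n : ℕ) : logisticDensity (r * q ^ (2 * n)) + logisticDensity (q ^ (2 * (n + 1)) / r)
      < logisticDensity (t * q ^ (2 * n)) + logisticDensity (q ^ (2 * (n + 1)) / t) := by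
    have hu0 : 0 < q ^ (2 * n) := by positivity
    have hu1 : q ^ (2 * n) ≤ 1 := pow_le_one₀ h0.le (by linarith)
    have hp : q ^ (2 * (n + 1)) = q ^ (2 * n) * q ^ 2 := by ring
    rw [hp]
    set u := q ^ (2 * n)
    have e (x : ℝ) (hx : 0 < x) : x * u * (u * q ^ 2 / x) = u ^ 2 * q ^ 2 := by field_simp
    have e' (x : ℝ) : x * u + u * q ^ 2 / x = u * (x + q ^ 2 / x) := by ring
    refine logisticDensity_add_lt (by positivity) (by positivity) (by positivity)
      (by positivity) ?_ ?_ ?_ ?_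
    · rw [e r hr0, e t ht0]
    · rw [e t ht0]
      calc u ^ 2 * q ^ 2 ≤ 1 ^ 2 * (1 / 19) ^ 2 := by gcongr
        _ = 1 / 361 := by norm_num
    · rw [e', e']
      gcongr
    · rw [e']
      refine (mul_le_of_le_one_left (by positivity) hu1).trans hsum'
  exact hs.tsum_lt_tsum (fun n ↦ (key n).le) (key 0) hs'

lemma tsum_even_pow (h0 : 0 < q) (h1 : q < 1) :
    ∑' n : ℕ, q ^ (2 * (n + 1)) = q ^ 2 / (1 - q ^ 2) := by
  have h (n : ℕ) : q ^ (2 * (n + 1)) = q ^ 2 * (q ^ 2) ^ n := by ring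
  simp_rw [h]
  rw [tsum_mul_left, tsum_geometric_of_lt_one (by positivity) (by nlinarith)]
  rfl

lemma periodizedLogistic_strictMonoOn_right (h0 : 0 < q) (h1 : q < 1 / 19) :
    StrictMonoOn (periodizedLogistic q) (Set.Icc (5 * q) 1) := by
  rintro r ⟨hr, hr'⟩ t ⟨ht, ht'⟩ hrt
  have hr0 : 0 < r := by linarith
  have ht0 : 0 < t := by linarith
  have hq1 : q < 1 := by linarith
  have hm := summable_logisticDensity_mul h0 hq1 hr0
  have hd := summable_logisticDensity_div h0 hq1 hr0
  have hm' := summable_logisticDensity_mul h0 hq1 ht0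
  have hd' := summable_logisticDensity_div h0 hq1 ht0
  have e : r + 1 / r - (t + 1 / t) = (t - r) * (1 - r * t) / (r * t) := by
    field_simp; ring
  have hrt1 : r * t < 1 := by nlinarith
  have hpos : 0 < r + 1 / r - (t + 1 / t) := by
    rw [e]
    exact div_pos (mul_pos (by linarith) (by linarith)) (by positivity)
  have key (n : ℕ) : logisticDensity (r * q ^ (2 * (n + 1)))
        + logisticDensity (q ^ (2 * (n + 1)) / r)
        - (logisticDensity (t * q ^ (2 * (n + 1))) + logisticDensity (q ^ (2 * (n + 1)) / t))
      ≤ q ^ (2 * (n + 1)) * (r + 1 / r - (t + 1 / t)) := by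
    have hu0 : 0 < q ^ (2 * (n + 1)) := by positivity
    have hu1 : q ^ (2 * (n + 1)) ≤ 1 := pow_le_one₀ h0.le (by linarith)
    set u := q ^ (2 * (n + 1))
    have e (x : ℝ) (hx : 0 < x) : x * u * (u / x) = u ^ 2 := by field_simp
    have e' (x : ℝ) : x * u + u / x = u * (x + 1 / x) := by ring
    refine (logisticDensity_add_sub_le (by positivity) (by positivity) (by positivity)
      (by positivity) ?_ ?_ ?_).trans_eq ?_
    · rw [e r hr0, e t ht0]
    · rw [e t ht0]
      exact pow_le_one₀ hu0.le hu1
    · rw [e', e']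
      exact mul_le_mul_of_nonneg_left (by linarith) hu0.le
    · rw [e', e']
      ring
  have hsum := ((hm.add hd).sub (hm'.add hd')).tsum_le_tsum key
    ((summable_even_pow h0 hq1).mul_right _)
  rw [(hm.add hd).tsum_sub (hm'.add hd'), hm.tsum_add hd, hm'.tsum_add hd', tsum_mul_right,
    tsum_even_pow h0 hq1] at hsum
  have hq2 : 16 / 25 < 1 - q ^ 2 := by nlinarith
  have hmain : q ^ 2 / (1 - q ^ 2) * (r + 1 / r - (t + 1 / t))
      < logisticDensity t - logisticDensity r := by
    have : logisticDensity t - logisticDensity r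
        = r * t / ((1 + r) ^ 2 * (1 + t) ^ 2) * (r + 1 / r - (t + 1 / t)) := by
      rw [e]
      simp only [logisticDensity]
      field_simp
      ring
    rw [this]
    refine mul_lt_mul_of_pos_right ?_ hpos
    have hden : (1 + r) ^ 2 * (1 + t) ^ 2 ≤ 16 := by
      calc (1 + r) ^ 2 * (1 + t) ^ 2 ≤ (1 + 1) ^ 2 * (1 + 1) ^ 2 := by gcongr
        _ = 16 := by norm_num
    calc q ^ 2 / (1 - q ^ 2) < q ^ 2 / (16 / 25) := by gcongr
      _ = (5 * q) * (5 * q) / 16 := by ring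
      _ ≤ r * t / 16 := by gcongr
      _ ≤ r * t / ((1 + r) ^ 2 * (1 + t) ^ 2) := by gcongr
  simp only [periodizedLogistic]
  linarith

lemma periodizedLogistic_strictMonoOn_of_small (h0 : 0 < q) (h1 : q < 1 / 19) :
    StrictMonoOn (periodizedLogistic q) (Set.Icc q 1) := by
  have := (periodizedLogistic_strictMonoOn_left h0 h1).union
    (periodizedLogistic_strictMonoOn_right h0 h1) (isGreatest_Icc (by linarith))
    (isLeast_Icc (by linarith))
  rwa [Set.Icc_union_Icc_eq_Icc (by linarith) (by linarith)] at this
end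

lemma hasSum_one_div_add_int_sq {z : ℂ} (hz : z.im ≠ 0) :
    HasSum (fun n : ℤ ↦ 1 / (z + n) ^ 2)
      ((2 * Real.pi * Complex.I) ^ 2 * (Complex.exp (2 * Real.pi * Complex.I * z)
        / (1 - Complex.exp (2 * Real.pi * Complex.I * z)) ^ 2)) := by
  wlog h : 0 < z.im generalizing z
  · have := @this (-z) (by simpa) (by simpa using (not_lt.1 h).lt_of_ne hz)
    rw [← (Equiv.neg ℤ).hasSum_iff] at this
    convert this using 1
    · ext n
      simp only [Function.comp_apply, Equiv.neg_apply, Int.cast_neg]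
      rw [show -z + -(n : ℂ) = -(z + n) by ring, neg_sq]
    · rw [mul_neg, Complex.exp_neg]
      have := Complex.exp_ne_zero (2 * Real.pi * Complex.I * z)
      set x := Complex.exp (2 * Real.pi * Complex.I * z)
      rw [show 1 - x⁻¹ = -(1 - x) / x by field_simp; ring, div_pow, neg_sq]
      by_cases hx : 1 - x = 0
      · simp [hx]
      · field_simp
  · have hs : Summable fun n : ℤ ↦ 1 / (z + n) ^ 2 := by
      refine (EisensteinSeries.linear_right_summable z 1 (le_refl 2)).congr fun n ↦ ?_
      norm_cast
      simp
    have hn : ‖Complex.exp (2 * Real.pi * Complex.I * z)‖ < 1 := by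
      rw [Complex.norm_exp, Real.exp_lt_one_iff]
      simp
      positivity
    have key := EisensteinSeries.qExpansion_identity (le_refl 1) ⟨z, h⟩
    simp only [pow_one, Nat.factorial_one, Nat.cast_one, div_one] at key
    rw [tsum_coe_mul_geometric_of_norm_lt_one hn] at key
    convert hs.hasSum using 1
    rw [key]
    ring

lemma hasSum_one_div_add_int_mul_sq {w p : ℂ} (hp : p ≠ 0) (hw : (w / p).im ≠ 0) :
    HasSum (fun n : ℤ ↦ 1 / (w + n * p) ^ 2)
      ((2 * Real.pi * Complex.I / p) ^ 2 * (Complex.exp (2 * Real.pi * Complex.I * (w / p))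
        / (1 - Complex.exp (2 * Real.pi * Complex.I * (w / p))) ^ 2)) := by
  have h := (hasSum_one_div_add_int_sq hw).mul_left (1 / p ^ 2)
  have e (n : ℤ) : 1 / p ^ 2 * (1 / (w / p + n) ^ 2) = 1 / (w + n * p) ^ 2 := by
    rw [show w + n * p = p * (w / p + n) by field_simp, mul_pow, one_div_mul_one_div]
  simp only [e] at h
  rwa [show (2 * Real.pi * Complex.I / p) ^ 2 = 1 / p ^ 2 * (2 * Real.pi * Complex.I) ^ 2 by ring,
    mul_assoc]

/-- Two copies of the Eisenstein-type series of weight two over a rectangular lattice have an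
absolutely summable difference. -/
lemma summable_one_div_sq_sub_one_div_sq {L : ℝ} (hL : 0 < L) (v w : ℂ) :
    Summable fun x : ℤ × ℤ ↦
      1 / (v + x.1 * (2 * L : ℂ) + x.2 * (2 * Real.pi * Complex.I)) ^ 2
      - 1 / (w + x.1 * (2 * L : ℂ) + x.2 * (2 * Real.pi * Complex.I)) ^ 2 := by
  have hind : LinearIndependent ℝ ![(2 * L : ℂ), 2 * Real.pi * Complex.I] := by
    rw [LinearIndependent.pair_iff]
    intro a b hab
    have h1 := congrArg Complex.re hab
    have h2 := congrArg Complex.im hab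
    simp [hL.ne', Real.pi_ne_zero] at h1 h2
    exact ⟨h1, h2⟩
  let P : PeriodPair := ⟨_, _, hind⟩
  have h := (P.hasSum_weierstrassP (-v)).summable.sub (P.hasSum_weierstrassP (-w)).summable
  rw [← P.latticeEquivProd.symm.toEquiv.summable_iff] at h
  refine h.congr fun x ↦ ?_
  have e : ((P.latticeEquivProd.symm x : P.lattice) : ℂ)
      = x.1 * (2 * L : ℂ) + x.2 * (2 * Real.pi * Complex.I) := P.latticeEquiv_symm_apply x
  simp only [Function.comp_apply, LinearEquiv.coe_toEquiv, e, sub_sub_sub_cancel_right]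
  congr 2 <;> ring

lemma re_exp_div_one_sub_exp_sq {x : ℝ} (hx : x ≠ 0) (y : ℝ) :
    (Complex.exp (x + y * Complex.I) / (1 - Complex.exp (x + y * Complex.I)) ^ 2).re
      = (Real.cos y * Real.cosh x - 1) / (2 * (Real.cosh x - Real.cos y) ^ 2) := by
  set w : ℂ := x + y * Complex.I with hw
  have h1 : Complex.exp w / (1 - Complex.exp w) ^ 2 = (2 * (Complex.cosh w - 1))⁻¹ := by
    rw [Complex.cosh, Complex.exp_neg]
    have := Complex.exp_ne_zero w
    set E := Complex.exp w
    rw [show 2 * ((E + E⁻¹) / 2 - 1) = (1 - E) ^ 2 / E by field_simp; ring, inv_div]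
  have h2 : Complex.cosh w - 1 = ((Real.cosh x * Real.cos y - 1 : ℝ) : ℂ)
      + ((Real.sinh x * Real.sin y : ℝ) : ℂ) * Complex.I := by
    rw [hw, Complex.cosh_add, Complex.cosh_mul_I, Complex.sinh_mul_I]
    push_cast
    ring
  have h3 : Complex.normSq (Complex.cosh w - 1) = (Real.cosh x - Real.cos y) ^ 2 := by
    rw [h2, Complex.normSq_add_mul_I]
    have := Real.cosh_sq x
    have := Real.sin_sq_add_cos_sq y
    nlinarith
  have h4 : (Complex.cosh w - 1).re = Real.cosh x * Real.cos y - 1 := by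
    rw [h2, Complex.add_re, Complex.re_ofReal_mul, Complex.ofReal_re, Complex.I_re, mul_zero,
      add_zero]
  have h5 : 0 < Real.cosh x - Real.cos y := by
    linarith [Real.one_lt_cosh.2 hx, Real.cos_le_one y]
  rw [h1, mul_inv, show (2 : ℂ)⁻¹ = ((2⁻¹ : ℝ) : ℂ) by simp, Complex.re_ofReal_mul,
    Complex.inv_re, h3, h4]
  field_simp

lemma mul_sub_one_div_sq_lt {C c c' : ℝ} (hC : 2 ≤ C) (hc : -1 ≤ c) (hcc : c < c')
    (hc' : c' ≤ 1) :
    (c * C - 1) / (2 * (C - c) ^ 2) < (c' * C - 1) / (2 * (C - c') ^ 2) := by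
  have e (x : ℝ) (hx : x ≤ 1) : (x * C - 1) / (2 * (C - x) ^ 2)
      = ((C ^ 2 - 1) * (C - x)⁻¹ ^ 2 - C * (C - x)⁻¹) / 2 := by
    have : C - x ≠ 0 := by linarith
    field_simp
    ring
  rw [e c (by linarith), e c' hc']
  have h1 : (C + 1)⁻¹ ≤ (C - c)⁻¹ := inv_anti₀ (by linarith) (by linarith)
  have h2 : (C - c)⁻¹ < (C - c')⁻¹ := by
    gcongr
    linarith
  have h3 : (C ^ 2 - 1) * (C + 1)⁻¹ = C - 1 := by
    field_simp; ring
  have h4 : 0 < (C ^ 2 - 1) := by nlinarith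
  set u := (C - c)⁻¹
  set u' := (C - c')⁻¹
  have h5 : C - 1 ≤ (C ^ 2 - 1) * u := h3 ▸ mul_le_mul_of_nonneg_left h1 h4.le
  have h6 : (C ^ 2 - 1) * u < (C ^ 2 - 1) * u' := mul_lt_mul_of_pos_left h2 h4
  have : 0 < (u' - u) * ((C ^ 2 - 1) * u + (C ^ 2 - 1) * u' - C) :=
    mul_pos (by linarith) (by linarith)
  nlinarith

lemma logisticDensity_inv {x : ℝ} (hx : 0 < x) : logisticDensity x⁻¹ = logisticDensity x := by
  simp only [logisticDensity]
  field_simp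
  ring

lemma hasSum_periodizedLogistic {L : ℝ} (hL : 0 < L) (s : ℝ) :
    HasSum (fun n : ℤ ↦ logisticDensity (Real.exp (s + n * (2 * L))))
      (periodizedLogistic (Real.exp (-L)) (Real.exp s)) := by
  have h0 := Real.exp_pos (-L)
  have h1 : Real.exp (-L) < 1 := Real.exp_lt_one_iff.2 (by linarith)
  have hr := Real.exp_pos s
  have hp (n : ℕ) : Real.exp (-L) ^ (2 * (n + 1)) = Real.exp (-((n + 1) * (2 * L))) := by
    rw [← Real.exp_nat_mul]
    push_cast
    ring_nf
  rw [periodizedLogistic, add_right_comm]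
  refine HasSum.of_nat_of_neg_add_one ?_ ?_
  · have h := (summable_logisticDensity_div h0 h1 hr).hasSum
    have e (n : ℕ) : logisticDensity (Real.exp (-L) ^ (2 * (n + 1)) / Real.exp s)
        = logisticDensity (Real.exp (s + ((n + 1 : ℕ) : ℤ) * (2 * L))) := by
      rw [hp, ← Real.exp_sub, ← logisticDensity_inv (Real.exp_pos _), ← Real.exp_neg]
      congr 2
      push_cast
      ring
    simp only [e] at h ⊢
    have := (hasSum_nat_add_iff
      (f := fun n : ℕ ↦ logisticDensity (Real.exp (s + (n : ℤ) * (2 * L)))) 1).1 h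
    simpa [add_comm] using this
  · convert (summable_logisticDensity_mul h0 h1 hr).hasSum using 3 with n
    rw [hp, ← Real.exp_add]
    push_cast
    ring_nf

lemma periodizedLogistic_exp_lt {L : ℝ} (hL : 0 < L) (hL3 : L ≤ 3) {s t : ℝ}
    (hs : -L < s) (hst : s < t) (ht : t < 0) :
    periodizedLogistic (Real.exp (-L)) (Real.exp s)
      < periodizedLogistic (Real.exp (-L)) (Real.exp t) := by
  have hpi := Real.pi_pos
  have hsum := (summable_one_div_sq_sub_one_div_sq hL (s + Real.pi * Complex.I)
    (t + Real.pi * Complex.I)).hasSum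
  set T := ∑' x : ℤ × ℤ, (1 / ((s + Real.pi * Complex.I : ℂ) + x.1 * (2 * L : ℂ)
      + x.2 * (2 * Real.pi * Complex.I)) ^ 2
    - 1 / ((t + Real.pi * Complex.I : ℂ) + x.1 * (2 * L : ℂ)
      + x.2 * (2 * Real.pi * Complex.I)) ^ 2)
  -- summing first in the imaginary direction gives the logistic densities
  have hrow {u : ℝ} (hu : -L < u) (hu' : u < 0) (n : ℤ) :
      HasSum (fun k : ℤ ↦ 1 / ((u + Real.pi * Complex.I : ℂ) + n * (2 * L : ℂ)
        + k * (2 * Real.pi * Complex.I)) ^ 2)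
        ((-logisticDensity (Real.exp (u + n * (2 * L))) : ℝ) : ℂ) := by
    have hne : u + n * (2 * L) ≠ 0 := by
      intro h
      have h1 : (n : ℝ) < 1 := by
        by_contra! h1
        nlinarith
      have h2 : (0 : ℝ) < n := by
        by_contra! h2
        nlinarith
      norm_cast at h1 h2
      lia
    have h2pi : 2 * Real.pi * Complex.I ≠ 0 := Complex.two_pi_I_ne_zero
    have := hasSum_one_div_add_int_mul_sq
      (w := (u + Real.pi * Complex.I : ℂ) + n * (2 * L : ℂ)) h2pi ?_
    · convert this using 1
      rw [mul_div_cancel₀ _ h2pi, div_self h2pi,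
        show (u + Real.pi * Complex.I : ℂ) + n * (2 * L : ℂ)
          = ((u + n * (2 * L) : ℝ) : ℂ) + Real.pi * Complex.I by push_cast; ring,
        Complex.exp_add, Complex.exp_pi_mul_I, ← Complex.ofReal_exp, logisticDensity]
      push_cast
      ring
    · rw [show ((u + Real.pi * Complex.I : ℂ) + n * (2 * L : ℂ)) / (2 * Real.pi * Complex.I)
        = ((1 / 2 : ℝ) : ℂ) + ((-((u + n * (2 * L)) / (2 * Real.pi)) : ℝ) : ℂ) * Complex.I by
          push_cast
          field_simp
          linear_combination (u + n * (2 * L) : ℂ) * Complex.I_sq]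
      simp only [Complex.add_im, Complex.ofReal_im, Complex.im_ofReal_mul, Complex.I_im, mul_one,
        zero_add]
      exact neg_ne_zero.2 (div_ne_zero hne (by positivity))
  have hL1 := hsum.prod_fiberwise fun n ↦ (hrow hs (hst.trans ht) n).sub (hrow (hs.trans hst) ht n)
  -- summing first in the real direction gives the dual expansion
  have hcol (u : ℝ) (k : ℤ) :
      HasSum (fun n : ℤ ↦ 1 / ((u + Real.pi * Complex.I : ℂ) + n * (2 * L : ℂ)
        + k * (2 * Real.pi * Complex.I)) ^ 2)
        (((-(Real.pi / L) ^ 2 : ℝ) : ℂ) *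
          (Complex.exp (((-((2 * k + 1) * (Real.pi ^ 2 / L)) : ℝ) : ℂ)
            + ((Real.pi * u / L : ℝ) : ℂ) * Complex.I) /
          (1 - Complex.exp (((-((2 * k + 1) * (Real.pi ^ 2 / L)) : ℝ) : ℂ)
            + ((Real.pi * u / L : ℝ) : ℂ) * Complex.I)) ^ 2)) := by
    have hL' : (L : ℂ) ≠ 0 := by exact_mod_cast hL.ne'
    have hw : 2 * Real.pi * Complex.I * (((u + Real.pi * Complex.I : ℂ)
          + k * (2 * Real.pi * Complex.I)) / (2 * L : ℂ))
        = ((-((2 * k + 1) * (Real.pi ^ 2 / L)) : ℝ) : ℂ)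
          + ((Real.pi * u / L : ℝ) : ℂ) * Complex.I := by
      push_cast
      field_simp
      linear_combination ((1 + 2 * k) * Real.pi : ℂ) * Complex.I_sq
    have h := hasSum_one_div_add_int_mul_sq
      (w := (u + Real.pi * Complex.I : ℂ) + k * (2 * Real.pi * Complex.I)) (p := 2 * L)
      (by simpa using hL.ne') ?_
    · rw [hw] at h
      convert h using 1
      · funext n
        rw [add_right_comm]
      · congr 1
        rw [show 2 * Real.pi * Complex.I / (2 * L) = (Real.pi / L : ℂ) * Complex.I by field_simp,
          mul_pow, Complex.I_sq]
        push_cast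
        ring
    · rw [show ((u + Real.pi * Complex.I : ℂ) + k * (2 * Real.pi * Complex.I)) / (2 * L : ℂ)
        = ((u / (2 * L) : ℝ) : ℂ)
          + (((2 * k + 1 : ℤ) * (Real.pi / (2 * L)) : ℝ) : ℂ) * Complex.I by
          push_cast; field_simp; ring]
      simp only [Complex.add_im, Complex.ofReal_im, Complex.im_ofReal_mul, Complex.I_im, mul_one,
        zero_add]
      exact mul_ne_zero (Int.cast_ne_zero.2 (by lia)) (by positivity)
  have hL2 := ((Equiv.prodComm ℤ ℤ).hasSum_iff.2 hsum).prod_fiberwise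
    fun k ↦ (hcol s k).sub (hcol t k)
  have hpos : 0 < T.re := by
    have hre := Complex.hasSum_re hL2
    have hcos : Real.cos (Real.pi * s / L) < Real.cos (Real.pi * t / L) := by
      rw [← Real.cos_neg, ← Real.cos_neg (Real.pi * t / L)]
      refine Real.cos_lt_cos_of_nonneg_of_le_pi ?_ ?_ ?_
      · rw [← neg_div, ← mul_neg]
        exact div_nonneg (mul_nonneg hpi.le (by linarith)) hL.le
      · rw [← neg_div, div_le_iff₀ hL]
        nlinarith
      · gcongr
    have hterm (k : ℤ) : 0 < (((-(Real.pi / L) ^ 2 : ℝ) : ℂ) *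
          (Complex.exp (((-((2 * k + 1) * (Real.pi ^ 2 / L)) : ℝ) : ℂ)
            + ((Real.pi * s / L : ℝ) : ℂ) * Complex.I) /
          (1 - Complex.exp (((-((2 * k + 1) * (Real.pi ^ 2 / L)) : ℝ) : ℂ)
            + ((Real.pi * s / L : ℝ) : ℂ) * Complex.I)) ^ 2)
        - ((-(Real.pi / L) ^ 2 : ℝ) : ℂ) *
          (Complex.exp (((-((2 * k + 1) * (Real.pi ^ 2 / L)) : ℝ) : ℂ)
            + ((Real.pi * t / L : ℝ) : ℂ) * Complex.I) /
          (1 - Complex.exp (((-((2 * k + 1) * (Real.pi ^ 2 / L)) : ℝ) : ℂ)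
            + ((Real.pi * t / L : ℝ) : ℂ) * Complex.I)) ^ 2)).re := by
      have hβ : 3 ≤ Real.pi ^ 2 / L := by
        rw [le_div_iff₀ hL]
        nlinarith [Real.pi_gt_three]
      have habs : 3 ≤ |-((2 * k + 1) * (Real.pi ^ 2 / L))| := by
        have h1 : (1 : ℝ) ≤ |(2 * k + 1 : ℝ)| := by
          exact_mod_cast Int.one_le_abs (z := 2 * k + 1) (by lia)
        rw [abs_neg, abs_mul, abs_of_pos (show 0 < Real.pi ^ 2 / L by linarith)]
        nlinarith
      have hx : -((2 * k + 1) * (Real.pi ^ 2 / L)) ≠ 0 := by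
        intro h
        rw [h] at habs
        norm_num at habs
      have hcosh : 2 ≤ Real.cosh (-((2 * k + 1) * (Real.pi ^ 2 / L))) := by
        rw [← Real.cosh_abs, Real.cosh_eq]
        have := Real.add_one_le_exp |-((2 * k + 1) * (Real.pi ^ 2 / L))|
        have := Real.exp_pos (-|-((2 * k + 1) * (Real.pi ^ 2 / L))|)
        linarith
      rw [Complex.sub_re, Complex.re_ofReal_mul, Complex.re_ofReal_mul,
        re_exp_div_one_sub_exp_sq hx, re_exp_div_one_sub_exp_sq hx]
      have := mul_sub_one_div_sq_lt hcosh (Real.neg_one_le_cos _) hcos (Real.cos_le_one _)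
      have : 0 < (Real.pi / L) ^ 2 := by positivity
      nlinarith
    exact hasSum_lt (fun k ↦ (hterm k).le) (hterm 0) hasSum_zero hre
  have hre := Complex.hasSum_re hL1
  have hG := (hasSum_periodizedLogistic hL t).sub (hasSum_periodizedLogistic hL s)
  simp only [Complex.sub_re, Complex.ofReal_re, neg_sub_neg] at hre
  have := hre.unique hG
  linarith

lemma StrictMonoOn.Icc_of_Ioo {f : ℝ → ℝ} {a b : ℝ} (hf : StrictMonoOn f (Set.Ioo a b))
    (hc : ContinuousOn f (Set.Icc a b)) : StrictMonoOn f (Set.Icc a b) := by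
  intro r hr t ht hrt
  obtain ⟨u, hru, hut⟩ := exists_between hrt
  obtain ⟨v, huv, hvt⟩ := exists_between hut
  have hu : u ∈ Set.Ioo a b := ⟨hr.1.trans_lt hru, hut.trans_le ht.2⟩
  have hv : v ∈ Set.Ioo a b := ⟨hu.1.trans huv, hvt.trans_le ht.2⟩
  have hleft : f r ≤ f u := by
    refine ContinuousWithinAt.closure_le (s := Set.Ioo r u) (g := fun _ ↦ f u) ?_
      ((hc r hr).mono (Set.Ioo_subset_Icc_self.trans (Set.Icc_subset_Icc hr.1 hu.2.le)))
      continuousWithinAt_const fun y hy ↦ (hf ⟨hr.1.trans_lt hy.1, hy.2.trans hu.2⟩ hu hy.2).le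
    rw [closure_Ioo hru.ne]
    exact Set.left_mem_Icc.2 hru.le
  have hright : f v ≤ f t := by
    refine ContinuousWithinAt.closure_le (s := Set.Ioo v t) (f := fun _ ↦ f v) ?_
      continuousWithinAt_const
      ((hc t ht).mono (Set.Ioo_subset_Icc_self.trans (Set.Icc_subset_Icc hv.1.le ht.2)))
      fun y hy ↦ (hf hv ⟨hv.1.trans hy.1, hy.2.trans_le ht.2⟩ hy.1).le
    rw [closure_Ioo hvt.ne]
    exact Set.right_mem_Icc.2 hvt.le
  exact hleft.trans_lt ((hf hu hv huv).trans_le hright)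

lemma periodizedLogistic_strictMonoOn {q : ℝ} (h0 : 0 < q) (h1 : q < 1) :
    StrictMonoOn (periodizedLogistic q) (Set.Icc q 1) := by
  rcases lt_or_ge q (1 / 19) with h | h
  · exact periodizedLogistic_strictMonoOn_of_small h0 h
  have hL : 0 < -Real.log q := neg_pos.2 (Real.log_neg h0 h1)
  have hL3 : -Real.log q ≤ 3 := by
    rw [neg_le, Real.le_log_iff_exp_le h0, Real.exp_neg]
    refine (inv_anti₀ (by norm_num) ?_ : _ ≤ (19 : ℝ)⁻¹).trans (by linarith)
    rw [show (3 : ℝ) = (3 : ℕ) * 1 by norm_num, Real.exp_nat_mul]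
    calc (19 : ℝ) ≤ 2.7 ^ 3 := by norm_num
      _ ≤ Real.exp 1 ^ 3 := by
        gcongr
        linarith [Real.exp_one_gt_d9]
  have hopen : StrictMonoOn (periodizedLogistic q) (Set.Ioo q 1) := by
    rintro r ⟨hr, hr'⟩ t ⟨ht, ht'⟩ hrt
    have := periodizedLogistic_exp_lt hL hL3 (s := Real.log r) (t := Real.log t)
      (by simpa using Real.log_lt_log h0 hr) (Real.log_lt_log (h0.trans hr) hrt)
      (Real.log_neg (h0.trans ht) ht')
    rwa [neg_neg, Real.exp_log h0, Real.exp_log (h0.trans hr), Real.exp_log (h0.trans ht)] at this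
  exact hopen.Icc_of_Ioo (continuousOn_periodizedLogistic h0 h1)

/-- Existence of a unique critical weight `r₀ ∈ (q,1)` at which `κ` changes
sign: `κ < 0` on `(q, r₀)` and `κ > 0` on `(r₀, 1)`; in particular
`κ(q) < 0 < κ(1)`. -/
theorem kappa_sign_change (q : ℝ) (hq : q ∈ Set.Ioo (0 : ℝ) 1) :
    (∃ r₀ ∈ Set.Ioo q 1, kappa q r₀ = 0 ∧
      (∀ r ∈ Set.Ioo q r₀, kappa q r < 0) ∧
      (∀ r ∈ Set.Ioo r₀ (1 : ℝ), 0 < kappa q r) ∧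
      (∀ r ∈ Set.Ioo q (1 : ℝ), kappa q r = 0 → r = r₀)) ∧
    kappa q q < 0 ∧ 0 < kappa q 1 := by
  obtain ⟨h0, h1⟩ := hq
  have hmono : StrictMonoOn (fun r ↦ W q (-r)) (Set.Icc q 1) := fun r hr t ht hrt ↦ by
    simp only [W_neg]
    linarith [periodizedLogistic_strictMonoOn h0 h1 hr ht hrt]
  have hcont : ContinuousOn (fun r ↦ W q (-r)) (Set.Icc q 1) := by
    simp only [W_neg]
    exact continuousOn_const.add (continuousOn_periodizedLogistic h0 h1)
  have hqm : q ∈ Set.Icc q 1 := ⟨le_rfl, h1.le⟩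
  have h1m : (1 : ℝ) ∈ Set.Icc q 1 := ⟨h1.le, le_rfl⟩
  have h12 : e2 q < e1 q := hmono hqm h1m h1
  have hsum := e1_add_e2_add_e3 h0 h1
  have h3 := e3_neg h0 h1
  have hkq : kappa q q < 0 := by
    have : kappa q q = 3 * ((e2 q - e1 q) * (e2 q + e1 q)) := by
      simp only [kappa, g2, show W q (-q) = e2 q from rfl]
      rw [show e3 q = -e1 q - e2 q by linarith]
      ring
    rw [this]
    nlinarith
  have hk1 : 0 < kappa q 1 := by
    have : kappa q 1 = 2 * (e1 q - e2 q) * (2 * e1 q + e2 q) := by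
      simp only [kappa, g2, show W q (-1) = e1 q from rfl]
      rw [show e3 q = -e1 q - e2 q by linarith]
      ring
    rw [this]
    nlinarith
  have hkc : ContinuousOn (kappa q) (Set.Icc q 1) := by
    unfold kappa
    fun_prop
  obtain ⟨r₀, hr₀, hz⟩ := intermediate_value_Ioo h1.le hkc ⟨hkq, hk1⟩
  have hneg : ∀ r ∈ Set.Ioo q r₀, kappa q r < 0 := by
    rintro r ⟨hr, hr'⟩
    have hlt := hmono hqm ⟨hr.le, (hr'.trans hr₀.2).le⟩ hr
    have hlt' := hmono ⟨hr.le, (hr'.trans hr₀.2).le⟩ ⟨hr₀.1.le, hr₀.2.le⟩ hr'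
    simp only [kappa] at hz hkq ⊢ hlt hlt'
    by_contra! hcon
    nlinarith [mul_pos (sub_pos.2 hlt) (sub_pos.2 hlt')]
  have hpos : ∀ r ∈ Set.Ioo r₀ (1 : ℝ), 0 < kappa q r := by
    rintro r ⟨hr, hr'⟩
    have hlt := hmono hqm ⟨hr₀.1.le, hr₀.2.le⟩ hr₀.1
    have hlt' := hmono ⟨hr₀.1.le, hr₀.2.le⟩ ⟨(hr₀.1.trans hr).le, hr'.le⟩ hr
    simp only [kappa] at hz hkq ⊢ hlt hlt'
    by_contra! hcon
    nlinarith [mul_pos (sub_pos.2 hlt) (sub_pos.2 hlt')]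
  refine ⟨⟨r₀, hr₀, hz, hneg, hpos, fun r hr hr0 ↦ ?_⟩, hkq, hk1⟩
  rcases lt_trichotomy r r₀ with h | h | h
  · exact absurd hr0 (hneg r ⟨hr.1, h⟩).ne
  · exact h
  · exact absurd hr0 (hpos r ⟨h, hr.2⟩).ne'
end

section
/- For every r > 0, the coefficient κ(r;q) converges as q → 0⁺ to the explicit rational function κ₀(r) := −(r⁴ + 12 r³ − 58 r² + 12 r + 1)/(16 (1+r)⁴); that is, lim_{q→0⁺} κ(r;q) = −(r⁴ + 12 r³ − 58 r² + 12 r + 1)/(16 (1+r)⁴). -/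
open Filter Topology

/-- If `|x| ≤ 1 / 2` then `x / (1 - x) ^ 2` is at most `4 |x|` in absolute value. -/
lemma abs_div_one_sub_sq_le {x : ℝ} (hx : |x| ≤ 1 / 2) : |x / (1 - x) ^ 2| ≤ 4 * |x| := by
  have h : 1 / 2 ≤ 1 - x := by linarith [le_abs_self x]
  have h2 : 1 / 4 ≤ (1 - x) ^ 2 := by nlinarith
  rw [abs_div, abs_of_pos (by linarith : 0 < (1 - x) ^ 2), div_le_iff₀ (by linarith)]
  nlinarith [abs_nonneg x]

/-- A Lambert-type series whose arguments are dominated by `C q ^ (n + 1)` vanishes as `q → 0⁺`. -/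
lemma tendsto_tsum_div_one_sub_sq {a : ℝ → ℕ → ℝ} {C : ℝ}
    (ha : ∀ᶠ q in 𝓝[>] (0 : ℝ), ∀ n, |a q n| ≤ C * q ^ (n + 1)) :
    Tendsto (fun q => ∑' n, a q n / (1 - a q n) ^ 2) (𝓝[>] (0 : ℝ)) (𝓝 0) := by
  have hid : Tendsto (fun q : ℝ => q) (𝓝[>] (0 : ℝ)) (𝓝 0) := nhdsWithin_le_nhds
  have hCq : Tendsto (fun q : ℝ => C * q) (𝓝[>] (0 : ℝ)) (𝓝 0) := by
    simpa using hid.const_mul C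
  have hbound : Tendsto (fun q : ℝ => 4 * (C * q) * (1 - q)⁻¹) (𝓝[>] (0 : ℝ)) (𝓝 0) := by
    simpa using (hCq.const_mul 4).mul ((hid.const_sub 1).inv₀ (by norm_num))
  refine squeeze_zero_norm' ?_ hbound
  filter_upwards [ha, self_mem_nhdsWithin, hid.eventually_le_const (by norm_num : (0 : ℝ) < 1 / 2),
    hCq.eventually_le_const (by norm_num : (0 : ℝ) < 1 / 2)] with q hq hq0 hq1 hC
  have hq0 : 0 < q := hq0
  have hCq0 : 0 ≤ C * q := by simpa using (abs_nonneg _).trans (hq 0)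
  refine tsum_of_norm_bounded
    ((hasSum_geometric_of_lt_one hq0.le (by linarith)).mul_left (4 * (C * q))) fun n => ?_
  have hn : |a q n| ≤ C * q * q ^ n := (hq n).trans_eq (by ring)
  have hpow : q ^ n ≤ 1 := pow_le_one₀ hq0.le (by linarith)
  have hhalf : |a q n| ≤ 1 / 2 := hn.trans ((mul_le_of_le_one_right hCq0 hpow).trans hC)
  rw [Real.norm_eq_abs]
  linarith [abs_div_one_sub_sq_le hhalf]

/-- Only the first two terms of `W` survive as `q → 0⁺` when `q / z` and `z` stay bounded. -/
lemma tendsto_W {z : ℝ → ℝ} {C L : ℝ} (hz : ∀ᶠ q in 𝓝[>] (0 : ℝ), |z q| ≤ C)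
    (hz' : ∀ᶠ q in 𝓝[>] (0 : ℝ), |q / z q| ≤ C)
    (hL : Tendsto (fun q => z q / (1 - z q) ^ 2) (𝓝[>] (0 : ℝ)) (𝓝 L)) :
    Tendsto (fun q => W q (z q)) (𝓝[>] (0 : ℝ)) (𝓝 (-1 / 12 - L)) := by
  have hsmall : ∀ᶠ q in 𝓝[>] (0 : ℝ), 0 < q ∧ q ≤ 1 := by
    filter_upwards [Ioc_mem_nhdsGT (zero_lt_one' ℝ)] with q hq using hq
  have h1 : Tendsto (fun q : ℝ => ∑' n : ℕ, q ^ (2 * (n + 1)) / (1 - q ^ (2 * (n + 1))) ^ 2)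
      (𝓝[>] (0 : ℝ)) (𝓝 0) := by
    refine tendsto_tsum_div_one_sub_sq (C := 1) ?_
    filter_upwards [hsmall] with q ⟨hq0, hq1⟩ n
    rw [abs_of_pos (by positivity), one_mul]
    exact pow_le_pow_of_le_one hq0.le hq1 (by omega)
  have h2 : Tendsto
      (fun q : ℝ => ∑' n : ℕ, z q * q ^ (2 * (n + 1)) / (1 - z q * q ^ (2 * (n + 1))) ^ 2)
      (𝓝[>] (0 : ℝ)) (𝓝 0) := by
    refine tendsto_tsum_div_one_sub_sq (C := C) ?_
    filter_upwards [hsmall, hz] with q ⟨hq0, hq1⟩ hzq n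
    rw [abs_mul, abs_of_pos (by positivity : 0 < q ^ (2 * (n + 1)))]
    exact mul_le_mul hzq (pow_le_pow_of_le_one hq0.le hq1 (by omega)) (by positivity)
      ((abs_nonneg _).trans hzq)
  have h3 : Tendsto
      (fun q : ℝ => ∑' n : ℕ, (q ^ (2 * (n + 1)) / z q) / (1 - q ^ (2 * (n + 1)) / z q) ^ 2)
      (𝓝[>] (0 : ℝ)) (𝓝 0) := by
    refine tendsto_tsum_div_one_sub_sq (C := C) ?_
    filter_upwards [hsmall, hz'] with q ⟨hq0, hq1⟩ hzq n
    rw [show q ^ (2 * (n + 1)) / z q = q / z q * q ^ (2 * n + 1) by ring, abs_mul,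
      abs_of_pos (by positivity : 0 < q ^ (2 * n + 1))]
    exact mul_le_mul hzq (pow_le_pow_of_le_one hq0.le hq1 (by omega)) (by positivity)
      ((abs_nonneg _).trans hzq)
  simpa [W] using (((hL.const_sub (-1 / 12)).add (h1.const_mul 2)).sub h2).sub h3

lemma tendsto_W_const {z : ℝ} (hz : z ≠ 0) :
    Tendsto (fun q => W q z) (𝓝[>] (0 : ℝ)) (𝓝 (-1 / 12 - z / (1 - z) ^ 2)) := by
  refine tendsto_W (C := max |z| (1 / |z|)) (.of_forall fun _ => le_max_left _ _) ?_
    tendsto_const_nhds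
  filter_upwards [Ioc_mem_nhdsGT (zero_lt_one' ℝ)] with q hq
  have hz' : 0 < |z| := abs_pos.mpr hz
  rw [abs_div, abs_of_pos hq.1]
  exact le_max_of_le_right (by gcongr; exact hq.2)

lemma tendsto_W_mul_self {c : ℝ} (hc : |c| = 1) :
    Tendsto (fun q => W q (c * q)) (𝓝[>] (0 : ℝ)) (𝓝 (-1 / 12)) := by
  have hcq : Tendsto (fun q : ℝ => c * q) (𝓝[>] (0 : ℝ)) (𝓝 0) := by
    simpa using (show Tendsto (fun q : ℝ => q) (𝓝[>] (0 : ℝ)) (𝓝 0) from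
      nhdsWithin_le_nhds).const_mul c
  have hL : Tendsto (fun q : ℝ => c * q / (1 - c * q) ^ 2) (𝓝[>] (0 : ℝ)) (𝓝 0) := by
    simpa [Pi.div_def] using hcq.div ((hcq.const_sub 1).pow 2) (by norm_num)
  have := tendsto_W (C := 1) ?_ ?_ hL
  · simpa using this
  · filter_upwards [Ioc_mem_nhdsGT (zero_lt_one' ℝ)] with q hq
    rw [abs_mul, hc, one_mul, abs_of_pos hq.1]
    exact hq.2
  · filter_upwards [self_mem_nhdsWithin] with q hq
    have hq : 0 < q := hq
    rw [abs_div, abs_mul, hc, one_mul, div_self (abs_ne_zero.mpr (ne_of_gt hq))]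

/-- As `q → 0⁺`, `κ(r;q)` converges to
`κ₀(r) = -(r⁴ + 12r³ - 58r² + 12r + 1)/(16(1+r)⁴)`. -/
theorem kappa_limit_q_zero (r : ℝ) (hr : 0 < r) :
    Filter.Tendsto (fun q : ℝ => kappa q r) (nhdsWithin 0 (Set.Ioi 0))
      (nhds (-(r ^ 4 + 12 * r ^ 3 - 58 * r ^ 2 + 12 * r + 1) / (16 * (1 + r) ^ 4))) := by
  have hW := tendsto_W_const (neg_ne_zero.mpr hr.ne')
  have h1 : Tendsto e1 (𝓝[>] (0 : ℝ)) (𝓝 (-1 / 12 - -1 / (1 - -1) ^ 2)) :=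
    tendsto_W_const (by norm_num)
  have h2 : Tendsto e2 (𝓝[>] (0 : ℝ)) (𝓝 (-1 / 12)) := by
    change Tendsto (fun q => W q (-q)) _ _
    simpa using tendsto_W_mul_self (c := -1) (by norm_num)
  have h3 : Tendsto e3 (𝓝[>] (0 : ℝ)) (𝓝 (-1 / 12)) := by
    change Tendsto (fun q => W q q) _ _
    simpa using tendsto_W_mul_self (c := 1) (by norm_num)
  have hg := ((((h1.pow 2).add (h2.pow 2)).add (h3.pow 2)).const_mul 2).div_const 2
  have hk := (((hW.pow 2).const_mul 5).add ((h1.const_mul 2).mul hW)).sub ((h1.pow 2).add hg)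
  refine (congrArg (Tendsto _ _ ∘ nhds) ?_).mpr hk
  have hr' : 1 + r ≠ 0 := by positivity
  simp only [sub_neg_eq_add]
  field_simp
  ring
end
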